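/- arXiv:2605.02375 — 2 statements merged into one kernel-verified Lean document; each statement's English description precedes it below -/
import Mathlib

section
/- For every probability distribution π ≠ p* on Y (with KL(π‖a) < ∞), there exists β₀ > 0 such that for all β ∈ (0, β₀), J_β(p*) > J_β(π). That is, for sufficiently small β the filtered model is strictly preferred by the KL-controlled objective over any fixed competitor: over any π with expected validity E_π[v] < 1 because E_{p*}[v] = 1, and over any fully valid π ≠ p* because KL(p*‖a) < KL(π‖a). -/
noncomputable section

open scoped BigOperators Classical

variable {Y : Type*} [Countable Y]

/-- `q` is a probability mass function on the countable set `Y`. -/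
def IsPMF (q : Y → ℝ) : Prop := (∀ y, 0 ≤ q y) ∧ HasSum q 1

/-- Kullback–Leibler divergence `KL(q‖p) = Σ_y q(y)·log(q(y)/p(y))`, with value `+∞`
when `q` is not absolutely continuous with respect to `p` (or the series fails to sum). -/
def KL (q p : Y → ℝ) : EReal :=
  if (∀ y, p y = 0 → q y = 0) ∧ Summable (fun y => q y * Real.log (q y / p y))
  then ((∑' y, q y * Real.log (q y / p y) : ℝ) : EReal)
  else ⊤

/-- The mass `a(Y₁)` that the base model assigns to the valid set `Y₁ = {y | v y = 1}`. -/
def A1 (a v : Y → ℝ) : ℝ := ∑' y : {z : Y // v z = 1}, a y.1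

/-- `A₀ := 1 − A₁`. -/
def A0 (a v : Y → ℝ) : ℝ := 1 - A1 a v

/-- The filtered model `p*(y) = a(y)/A₁` on `Y₁`, and `0` on `Y₀`. -/
def pstar (a v : Y → ℝ) (y : Y) : ℝ :=
  if v y = 1 then a y / A1 a v else 0

/-- KL-controlled objective with reward `v`: `J_β(q) = E_{y∼q}[v(y)] − β·KL(q‖a)`. -/
def J (a v : Y → ℝ) (β : ℝ) (q : Y → ℝ) : EReal :=
  ((∑' y, q y * v y : ℝ) : EReal) - (β : EReal) * KL q a

lemma KL_eq_coe {q p : Y → ℝ} {s : ℝ} (hac : ∀ y, p y = 0 → q y = 0)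
    (h : HasSum (fun y => q y * Real.log (q y / p y)) s) : KL q p = (s : EReal) := by
  rw [KL, if_pos ⟨hac, h.summable⟩, h.tsum_eq]

lemma exists_hasSum_of_KL_ne_top {q p : Y → ℝ} (h : KL q p ≠ ⊤) :
    (∀ y, p y = 0 → q y = 0) ∧ ∃ s, HasSum (fun y => q y * Real.log (q y / p y)) s := by
  unfold KL at h
  split_ifs at h with hc
  · exact ⟨hc.1, _, hc.2.hasSum⟩
  · exact absurd rfl h

lemma J_eq_coe {a v q : Y → ℝ} {β e k : ℝ} (he : HasSum (fun y => q y * v y) e)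
    (hk : KL q a = (k : EReal)) : J a v β q = ((e - β * k : ℝ) : EReal) := by
  rw [J, he.tsum_eq, hk]
  push_cast
  rfl

lemma hasSum_pstar {a v : Y → ℝ} (ha : Summable a) (hA : 0 < A1 a v) :
    HasSum (pstar a v) 1 := by
  have h1 : HasSum (fun y : {z : Y // v z = 1} => a y.1) (A1 a v) :=
    (ha.subtype {z | v z = 1}).hasSum
  have h2 : HasSum ({z | v z = 1}.indicator a) (A1 a v) :=
    (hasSum_subtype_iff_indicator (s := {z | v z = 1})).1 h1
  have h3 := h2.div_const (A1 a v)
  rw [div_self hA.ne'] at h3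
  have hfun : pstar a v = fun y => {z | v z = 1}.indicator a y / A1 a v := by
    funext y
    by_cases hy : v y = 1 <;> simp [pstar, hy]
  rwa [hfun]

lemma hasSum_pstar_mul {a v : Y → ℝ} (ha : Summable a) (hA : 0 < A1 a v) :
    HasSum (fun y => pstar a v y * v y) 1 := by
  have hfun : (fun y => pstar a v y * v y) = pstar a v := by
    funext y
    by_cases hy : v y = 1 <;> simp [pstar, hy]
  rw [hfun]
  exact hasSum_pstar ha hA

lemma KL_pstar {a v : Y → ℝ} (ha : Summable a) (hfull : ∀ y, 0 < a y) (hA : 0 < A1 a v) :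
    KL (pstar a v) a = ((-Real.log (A1 a v) : ℝ) : EReal) := by
  refine KL_eq_coe (fun y hy => absurd hy (hfull y).ne') ?_
  have h := (hasSum_pstar ha hA).mul_right (-Real.log (A1 a v))
  rw [one_mul] at h
  have hfun : (fun y => pstar a v y * Real.log (pstar a v y / a y))
      = fun y => pstar a v y * -Real.log (A1 a v) := by
    funext y
    by_cases hy : v y = 1
    · have hay := (hfull y).ne'
      have : a y / A1 a v / a y = (A1 a v)⁻¹ := by field_simp
      simp only [pstar, hy, if_true, this, Real.log_inv]
    · simp [pstar, hy]
  rwa [hfun]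

/-- Strict Gibbs inequality against `p*`: among distributions supported on the valid set,
`p*` is the unique minimiser of the divergence from `a`. -/
lemma neg_log_A1_lt {a v π : Y → ℝ} {k : ℝ} (ha : Summable a) (hfull : ∀ y, 0 < a y)
    (hA : 0 < A1 a v) (hπ : IsPMF π) (hsupp : ∀ y, v y ≠ 1 → π y = 0)
    (hne : π ≠ pstar a v) (hk : HasSum (fun y => π y * Real.log (π y / a y)) k) :
    -Real.log (A1 a v) < k := by
  have hsum := ((hk.add (hπ.2.mul_right (Real.log (A1 a v)))).add (hasSum_pstar ha hA)).sub hπ.2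
  have hterm : ∀ y, v y = 1 →
      π y * Real.log (π y / a y) + π y * Real.log (A1 a v) + pstar a v y - π y
        = pstar a v y * InformationTheory.klFun (π y / pstar a v y) := by
    intro y hy
    have hay := hfull y
    have hp : 0 < pstar a v y := by simp only [pstar, hy, if_true]; positivity
    rw [InformationTheory.klFun_apply]
    rcases (hπ.1 y).eq_or_lt with h0 | h0
    · simp [← h0]
    · have hlog : Real.log (π y / pstar a v y)
          = Real.log (π y / a y) + Real.log (A1 a v) := by
        rw [← Real.log_mul (by positivity) hA.ne']
        congr 1
        simp only [pstar, hy, if_true]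
        field_simp
      rw [hlog]
      field_simp
  have hratio : ∀ y, v y = 1 → 0 ≤ π y / pstar a v y := by
    intro y hy
    simp only [pstar, hy, if_true]
    exact div_nonneg (hπ.1 y) (div_pos (hfull y) hA).le
  obtain ⟨y₀, hy₀⟩ := Function.ne_iff.1 hne
  have hv₀ : v y₀ = 1 := by
    by_contra h
    exact hy₀ (by simp [hsupp y₀ h, pstar, h])
  have hp : ∀ y, v y = 1 → 0 < pstar a v y := by
    intro y hy
    simp only [pstar, hy, if_true]
    exact div_pos (hfull y) hA
  have hpos : (0 : ℝ) < k + 1 * Real.log (A1 a v) + 1 - 1 := by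
    refine hasSum_lt (i := y₀) (f := fun _ => (0 : ℝ)) ?_ ?_ hasSum_zero hsum
    · intro y
      by_cases hy : v y = 1
      · simp only [hterm y hy]
        exact mul_nonneg (hp y hy).le (InformationTheory.klFun_nonneg (hratio y hy))
      · simp [hsupp y hy, pstar, hy]
    · simp only [hterm y₀ hv₀]
      refine mul_pos (hp y₀ hv₀)
        ((InformationTheory.klFun_nonneg (hratio y₀ hv₀)).lt_of_ne' fun h => hy₀ ?_)
      rw [InformationTheory.klFun_eq_zero_iff (hratio y₀ hv₀)] at h
      exact (div_eq_one_iff_eq (hp y₀ hv₀).ne').1 h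
  linarith

/-- For every probability distribution `π ≠ p*` on `Y` with
`KL(π‖a) < ∞`, there exists `β₀ > 0` such that for all `β ∈ (0, β₀)`,
`J_β(p*) > J_β(π)`. -/
theorem stmt10
    (a : Y → ℝ) (ha : IsPMF a) (hfull : ∀ y, 0 < a y)
    (v : Y → ℝ) (hv : ∀ y, v y = 0 ∨ v y = 1)
    (hY1 : ∃ y, v y = 1) (hY0 : ∃ y, v y = 0)
    (hA1 : 0 < A1 a v ∧ A1 a v < 1)
    (π : Y → ℝ) (hπ : IsPMF π) (hne : π ≠ pstar a v) (hfin : KL π a ≠ ⊤) :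
    ∃ β₀ > (0 : ℝ), ∀ β : ℝ, 0 < β → β < β₀ →
      J a v β π < J a v β (pstar a v) := by
  obtain ⟨-, k, hk⟩ := exists_hasSum_of_KL_ne_top hfin
  have hKL : KL π a = (k : EReal) := KL_eq_coe (fun y hy => absurd hy (hfull y).ne') hk
  have hle : ∀ y, π y * v y ≤ π y := by
    intro y
    rcases hv y with h | h <;> simp [h, hπ.1 y]
  have hnonneg : ∀ y, 0 ≤ π y * v y := by
    intro y
    rcases hv y with h | h <;> simp [h, hπ.1 y]
  obtain ⟨e, he⟩ := Summable.of_nonneg_of_le hnonneg hle hπ.2.summable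
  have he1 : e ≤ 1 := hasSum_le hle he hπ.2
  simp only [J_eq_coe he hKL, J_eq_coe (hasSum_pstar_mul ha.2.summable hA1.1)
    (KL_pstar ha.2.summable hfull hA1.1), EReal.coe_lt_coe_iff]
  rcases he1.lt_or_eq with hlt | heq
  · have hd : 0 < |-Real.log (A1 a v) - k| + 1 := by positivity
    refine ⟨(1 - e) / (|-Real.log (A1 a v) - k| + 1), div_pos (by linarith) hd, ?_⟩
    intro β hβ hβ'
    rw [lt_div_iff₀ hd] at hβ'
    have := mul_le_mul_of_nonneg_left (le_abs_self (-Real.log (A1 a v) - k)) hβ.le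
    linarith
  · have hsupp : ∀ y, v y ≠ 1 → π y = 0 := by
      intro y hy
      by_contra h
      have hv0 : v y = 0 := (hv y).resolve_right hy
      have := hasSum_lt (i := y) hle
        (by simpa [hv0] using (hπ.1 y).lt_of_ne' h) he hπ.2
      linarith
    have hlt := neg_log_A1_lt ha.2.summable hfull hA1.1 hπ hsupp hne hk
    refine ⟨1, one_pos, fun β hβ _ => ?_⟩
    have := mul_lt_mul_of_pos_left hlt hβ
    linarith

end
end

section
/- Let r : Y → ℝ be a bounded reward whose supremum M := sup_y r(y) is attained on the nonempty set Y_M := {y : r(y) = M}, with a(Y_M) < 1 (so r is non-constant on the support of a), and let p*(y) := a(y)/a(Y_M) for y ∈ Y_M and p*(y) := 0 otherwise. Then as λ → +∞: p_λ(y) → p*(y) for every y ∈ Y; KL(p*‖p_λ) → 0; KL(p_λ‖p*) = +∞ for every λ ∈ ℝ; and KL(p_λ‖a) → −log a(Y_M) = KL(p*‖a). -/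
noncomputable section

open scoped BigOperators Classical

variable {Y : Type*} [Countable Y]

/-- Normalization constant `Z_λ = Σ_y a(y)·e^{λ·r(y)}` of the exponential family. -/
def Zlam (a r : Y → ℝ) (lam : ℝ) : ℝ := ∑' y, a y * Real.exp (lam * r y)

/-- The exponential family member `p_λ(y) = a(y)·e^{λ·r(y)}/Z_λ`. -/
def pexp (a r : Y → ℝ) (lam : ℝ) (y : Y) : ℝ :=
  a y * Real.exp (lam * r y) / Zlam a r lam

/-- The log-partition function `A(λ) = log Z_λ`. -/
def logPart (a r : Y → ℝ) (lam : ℝ) : ℝ := Real.log (Zlam a r lam)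

/-- The supremum `M = sup_y r(y)` of the reward. -/
def Msup (r : Y → ℝ) : ℝ := ⨆ y, r y

/-- The mass `a(Y_M)` of the set `Y_M = {y : r(y) = M}` where the supremum is attained. -/
def aMax (a r : Y → ℝ) : ℝ := ∑' y : {z : Y // r z = Msup r}, a y.1

/-- The filtered model `p*(y) = a(y)/a(Y_M)` on `Y_M`, and `0` otherwise. -/
def pstarM (a r : Y → ℝ) (y : Y) : ℝ :=
  if r y = Msup r then a y / aMax a r else 0

open Filter Topology

/-- A bounded weighting of a probability mass function is summable. -/
lemma IsPMF.summable_mul_of_bound {Y : Type*} {a : Y → ℝ} (ha : IsPMF a) {f : Y → ℝ} {C : ℝ}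
    (hf : ∀ y, |f y| ≤ C) : Summable (fun y => a y * f y) := by
  refine Summable.of_norm_bounded (ha.2.summable.mul_right C) fun y => ?_
  rw [Real.norm_eq_abs, abs_mul, abs_of_nonneg (ha.1 y)]
  exact mul_le_mul_of_nonneg_left (hf y) (ha.1 y)

lemma le_Msup {Y : Type*} {r : Y → ℝ} (hbdd : ∃ C, ∀ y, |r y| ≤ C) (y : Y) : r y ≤ Msup r := by
  obtain ⟨C, hC⟩ := hbdd
  exact le_ciSup (f := r) ⟨C, by rintro _ ⟨z, rfl⟩; exact (abs_le.1 (hC z)).2⟩ y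

/-- The terms `a(y)·e^{λ·r(y)}` defining `Z_λ` are summable. -/
lemma IsPMF.summable_mul_exp {Y : Type*} {a r : Y → ℝ} (ha : IsPMF a) (hbdd : ∃ C, ∀ y, |r y| ≤ C)
    (lam : ℝ) : Summable (fun y => a y * Real.exp (lam * r y)) := by
  obtain ⟨C, hC⟩ := hbdd
  refine ha.summable_mul_of_bound (C := Real.exp (|lam| * C)) fun y => ?_
  rw [Real.abs_exp, Real.exp_le_exp]
  calc lam * r y ≤ |lam * r y| := le_abs_self _
    _ = |lam| * |r y| := abs_mul _ _
    _ ≤ |lam| * C := mul_le_mul_of_nonneg_left (hC y) (abs_nonneg _)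

lemma Zlam_pos {Y : Type*} [Nonempty Y] {a r : Y → ℝ} (ha : IsPMF a) (hfull : ∀ y, 0 < a y)
    (hbdd : ∃ C, ∀ y, |r y| ≤ C) (lam : ℝ) : 0 < Zlam a r lam :=
  (ha.summable_mul_exp hbdd lam).tsum_pos
    (fun y => (mul_pos (hfull y) (Real.exp_pos _)).le) (Classical.arbitrary Y)
    (mul_pos (hfull _) (Real.exp_pos _))

lemma pexp_pos {Y : Type*} [Nonempty Y] {a r : Y → ℝ} (ha : IsPMF a) (hfull : ∀ y, 0 < a y)
    (hbdd : ∃ C, ∀ y, |r y| ≤ C) (lam : ℝ) (y : Y) : 0 < pexp a r lam y :=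
  div_pos (mul_pos (hfull y) (Real.exp_pos _)) (Zlam_pos ha hfull hbdd lam)

lemma hasSum_pexp {Y : Type*} [Nonempty Y] {a r : Y → ℝ} (ha : IsPMF a) (hfull : ∀ y, 0 < a y)
    (hbdd : ∃ C, ∀ y, |r y| ≤ C) (lam : ℝ) : HasSum (pexp a r lam) 1 := by
  have h := (ha.summable_mul_exp hbdd lam).hasSum.div_const (Zlam a r lam)
  rwa [← Zlam, div_self (Zlam_pos ha hfull hbdd lam).ne'] at h

lemma hasSum_ite_aMax {Y : Type*} {a r : Y → ℝ} (ha : IsPMF a) :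
    HasSum (fun y => if r y = Msup r then a y else 0) (aMax a r) := by
  have h := (hasSum_subtype_iff_indicator (s := {z | r z = Msup r})).1
    (ha.2.summable.subtype {z | r z = Msup r}).hasSum
  refine h.congr_fun fun y => ?_
  simp [Set.indicator_apply]

lemma aMax_pos {Y : Type*} {a r : Y → ℝ} (ha : IsPMF a) (hfull : ∀ y, 0 < a y)
    (hattain : ∃ y, r y = Msup r) : 0 < aMax a r := by
  obtain ⟨y, hy⟩ := hattain
  exact (ha.2.summable.subtype {z | r z = Msup r}).tsum_pos
    (fun z => (hfull z.1).le) ⟨y, hy⟩ (hfull y)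

lemma hasSum_pstarM {Y : Type*} {a r : Y → ℝ} (ha : IsPMF a) (hfull : ∀ y, 0 < a y)
    (hattain : ∃ y, r y = Msup r) : HasSum (pstarM a r) 1 := by
  have h := (hasSum_ite_aMax (r := r) ha).div_const (aMax a r)
  rw [div_self (aMax_pos ha hfull hattain).ne'] at h
  refine h.congr_fun fun y => ?_
  simp only [pstarM]
  split_ifs <;> simp

lemma KL_eq_of_hasSum {Y : Type*} {q p : Y → ℝ} {c : ℝ} (hp : ∀ y, p y = 0 → q y = 0)
    (h : HasSum (fun y => q y * Real.log (q y / p y)) c) : KL q p = (c : EReal) := by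
  rw [KL, if_pos ⟨hp, h.summable⟩, h.tsum_eq]

/-- Normalizing the reward to have supremum `0` multiplies `Z_λ` by `e^{-λM}`. -/
lemma Zlam_sub_const {Y : Type*} (a r : Y → ℝ) (M lam : ℝ) :
    Zlam a (fun y => r y - M) lam = Zlam a r lam * Real.exp (-(lam * M)) := by
  rw [Zlam, Zlam, ← tsum_mul_right]
  refine tsum_congr fun y => ?_
  rw [mul_assoc, ← Real.exp_add]
  ring_nf

lemma pexp_sub_const {Y : Type*} (a r : Y → ℝ) (M lam : ℝ) (y : Y) :
    pexp a (fun y => r y - M) lam y = pexp a r lam y := by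
  have h : Real.exp (lam * (r y - M)) = Real.exp (lam * r y) * Real.exp (-(lam * M)) := by
    rw [← Real.exp_add]; ring_nf
  rw [pexp, pexp, Zlam_sub_const, h, ← mul_assoc, mul_div_mul_right _ _ (Real.exp_pos _).ne']

lemma tendsto_exp_mul_sub_Msup {Y : Type*} {r : Y → ℝ} (hbdd : ∃ C, ∀ y, |r y| ≤ C) (y : Y) :
    Tendsto (fun lam : ℝ => Real.exp (lam * (r y - Msup r))) atTop
      (𝓝 (if r y = Msup r then 1 else 0)) := by
  split_ifs with h
  · simp [h]
  · have hneg : r y - Msup r < 0 := sub_neg.2 (lt_of_le_of_ne (le_Msup hbdd y) h)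
    exact Real.tendsto_exp_atBot.comp (tendsto_id.atTop_mul_const_of_neg hneg)

lemma tendsto_Zlam_sub_Msup {Y : Type*} {a r : Y → ℝ} (ha : IsPMF a) (hbdd : ∃ C, ∀ y, |r y| ≤ C) :
    Tendsto (fun lam : ℝ => Zlam a (fun y => r y - Msup r) lam) atTop (𝓝 (aMax a r)) := by
  rw [← (hasSum_ite_aMax (r := r) ha).tsum_eq]
  refine tendsto_tsum_of_dominated_convergence ha.2.summable (fun y => ?_) ?_
  · simpa using (tendsto_exp_mul_sub_Msup hbdd y).const_mul (a y)
  · filter_upwards [eventually_ge_atTop 0] with lam hlam y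
    rw [Real.norm_eq_abs, abs_mul, abs_of_nonneg (ha.1 y), Real.abs_exp]
    exact mul_le_of_le_one_right (ha.1 y) (Real.exp_le_one_iff.2
      (mul_nonpos_of_nonneg_of_nonpos hlam (sub_nonpos.2 (le_Msup hbdd y))))

/-- The unnormalized mean of `λ(r - M)` under the tilted weights vanishes as `λ → +∞`. -/
lemma tendsto_tsum_mul_exp_mul {Y : Type*} {a r : Y → ℝ} (ha : IsPMF a)
    (hbdd : ∃ C, ∀ y, |r y| ≤ C) :
    Tendsto (fun lam : ℝ => ∑' y, a y * (Real.exp (lam * (r y - Msup r)) *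
      (lam * (r y - Msup r)))) atTop (𝓝 0) := by
  rw [← tsum_zero (α := ℝ) (β := Y)]
  refine tendsto_tsum_of_dominated_convergence ha.2.summable (fun y => ?_) ?_
  · rw [← mul_zero (a y)]
    refine Tendsto.const_mul _ ?_
    rcases eq_or_ne (r y) (Msup r) with h | h
    · simp [h]
    · have hneg : r y - Msup r < 0 := sub_neg.2 (lt_of_le_of_ne (le_Msup hbdd y) h)
      have h1 := (Real.tendsto_pow_mul_exp_neg_atTop_nhds_zero 1).comp
        (tendsto_id.atTop_mul_const (neg_pos.2 hneg))
      rw [← neg_zero]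
      refine h1.neg.congr fun lam => ?_
      simp only [Function.comp_apply, id, pow_one, mul_neg, neg_neg, neg_mul]
      ring
  · filter_upwards [eventually_ge_atTop 0] with lam hlam y
    rw [Real.norm_eq_abs, abs_mul, abs_of_nonneg (ha.1 y)]
    refine mul_le_of_le_one_right (ha.1 y) ?_
    have hx : lam * (r y - Msup r) ≤ 0 :=
      mul_nonpos_of_nonneg_of_nonpos hlam (sub_nonpos.2 (le_Msup hbdd y))
    set x := lam * (r y - Msup r)
    rw [abs_mul, Real.abs_exp, abs_of_nonpos hx]
    calc Real.exp x * -x ≤ Real.exp x * Real.exp (-x) :=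
          mul_le_mul_of_nonneg_left (by linarith [Real.add_one_le_exp (-x)]) (Real.exp_pos x).le
      _ = 1 := by rw [← Real.exp_add, add_neg_cancel, Real.exp_zero]

lemma KL_pstarM_pexp {Y : Type*} [Nonempty Y] {a r : Y → ℝ} (ha : IsPMF a) (hfull : ∀ y, 0 < a y)
    (hbdd : ∃ C, ∀ y, |r y| ≤ C) (hattain : ∃ y, r y = Msup r) (lam : ℝ) :
    KL (pstarM a r) (pexp a r lam) =
      (Real.log (Zlam a (fun y => r y - Msup r) lam / aMax a r) : ℝ) := by
  refine KL_eq_of_hasSum (fun y h => absurd h (pexp_pos ha hfull hbdd lam y).ne') ?_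
  have h := (hasSum_pstarM ha hfull hattain).mul_right
    (Real.log (Zlam a (fun y => r y - Msup r) lam / aMax a r))
  rw [one_mul] at h
  refine h.congr_fun fun y => ?_
  by_cases hy : r y = Msup r
  · rw [← pexp_sub_const a r (Msup r), pstarM, if_pos hy, pexp, hy, sub_self, mul_zero,
      Real.exp_zero, mul_one, div_div_div_eq, mul_comm (aMax a r),
      mul_div_mul_left _ _ (hfull y).ne']
  · simp [pstarM, hy]

lemma KL_pexp_self {Y : Type*} [Nonempty Y] {a r : Y → ℝ} (ha : IsPMF a) (hfull : ∀ y, 0 < a y)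
    (hbdd : ∃ C, ∀ y, |r y| ≤ C) (lam : ℝ) :
    KL (pexp a r lam) a =
      ((∑' y, a y * (Real.exp (lam * r y) * (lam * r y))) / Zlam a r lam
        - Real.log (Zlam a r lam) : ℝ) := by
  refine KL_eq_of_hasSum (fun y h => absurd h (hfull y).ne') ?_
  have hZ := Zlam_pos ha hfull hbdd lam
  have hs : Summable (fun y => a y * (Real.exp (lam * r y) * (lam * r y))) := by
    obtain ⟨C, hC⟩ := hbdd
    have hb : ∀ y, |lam * r y| ≤ |lam| * C := fun y => by
      rw [abs_mul]; exact mul_le_mul_of_nonneg_left (hC y) (abs_nonneg _)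
    refine ha.summable_mul_of_bound (C := Real.exp (|lam| * C) * (|lam| * C)) fun y => ?_
    rw [abs_mul, Real.abs_exp]
    exact mul_le_mul (Real.exp_le_exp.2 ((le_abs_self _).trans (hb y))) (hb y) (abs_nonneg _)
      (Real.exp_pos _).le
  have h := (hs.hasSum.div_const (Zlam a r lam)).sub
    ((hasSum_pexp ha hfull hbdd lam).mul_right (Real.log (Zlam a r lam)))
  rw [one_mul] at h
  refine h.congr_fun fun y => ?_
  have h1 : pexp a r lam y / a y = Real.exp (lam * r y) / Zlam a r lam := by
    rw [pexp, mul_div_assoc, mul_div_cancel_left₀ _ (hfull y).ne']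
  rw [h1, Real.log_div (Real.exp_pos _).ne' hZ.ne', Real.log_exp, pexp]
  ring

/-- If the supremum `M` of the bounded reward `r` is attained on the
nonempty set `Y_M` with `a(Y_M) < 1`, then as `λ → +∞`: `p_λ(y) → p*(y)` for every `y`;
`KL(p*‖p_λ) → 0`; `KL(p_λ‖p*) = +∞` for every `λ`; and
`KL(p_λ‖a) → −log a(Y_M) = KL(p*‖a)`. -/
theorem stmt19 [Nonempty Y]
    (a : Y → ℝ) (ha : IsPMF a) (hfull : ∀ y, 0 < a y)
    (r : Y → ℝ) (hbdd : ∃ C, ∀ y, |r y| ≤ C)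
    (hattain : ∃ y, r y = Msup r)
    (hlt : aMax a r < 1) :
    (∀ y : Y, Tendsto (fun lam : ℝ => pexp a r lam y) atTop (𝓝 (pstarM a r y))) ∧
    Tendsto (fun lam : ℝ => KL (pstarM a r) (pexp a r lam)) atTop (𝓝 (0 : EReal)) ∧
    (∀ lam : ℝ, KL (pexp a r lam) (pstarM a r) = ⊤) ∧
    Tendsto (fun lam : ℝ => KL (pexp a r lam) a) atTop
      (𝓝 ((-Real.log (aMax a r) : ℝ) : EReal)) ∧
    KL (pstarM a r) a = ((-Real.log (aMax a r) : ℝ) : EReal) := by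
  have hA := aMax_pos ha hfull hattain
  have hZ := tendsto_Zlam_sub_Msup ha hbdd
  have hbdd' : ∃ C, ∀ y, |r y - Msup r| ≤ C := by
    obtain ⟨C, hC⟩ := hbdd
    exact ⟨C + |Msup r|, fun y => (abs_sub _ _).trans (add_le_add_left (hC y) _)⟩
  refine ⟨fun y => ?_, ?_, fun lam => ?_, ?_, ?_⟩
  · have h := ((tendsto_exp_mul_sub_Msup hbdd y).const_mul (a y)).div hZ hA.ne'
    have hstar : pstarM a r y = a y * (if r y = Msup r then 1 else 0) / aMax a r := by
      simp only [pstarM]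
      split_ifs <;> simp
    rw [hstar]
    exact h.congr fun lam => pexp_sub_const a r (Msup r) lam y
  · simp only [KL_pstarM_pexp ha hfull hbdd hattain]
    rw [← EReal.coe_zero, EReal.tendsto_coe, ← Real.log_one, ← div_self hA.ne']
    exact (hZ.div_const _).log (div_pos hA hA).ne'
  · rw [KL, if_neg]
    rintro ⟨hac, -⟩
    refine hlt.ne ((hasSum_ite_aMax (r := r) ha).unique ?_)
    refine ha.2.congr_fun fun y => ?_
    by_cases hy : r y = Msup r
    · rw [if_pos hy]
    · exact absurd (hac y (if_neg hy)) (pexp_pos ha hfull hbdd lam y).ne'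
  · have hKL : ∀ lam, KL (pexp a r lam) a = _ := fun lam => by
      rw [← funext (pexp_sub_const a r (Msup r) lam), KL_pexp_self ha hfull hbdd' lam]
    simp only [hKL]
    rw [EReal.tendsto_coe]
    simpa using ((tendsto_tsum_mul_exp_mul ha hbdd).div hZ hA.ne').sub (hZ.log hA.ne')
  · refine KL_eq_of_hasSum (fun y h => absurd h (hfull y).ne') ?_
    have h := (hasSum_pstarM ha hfull hattain).mul_right (-Real.log (aMax a r))
    rw [one_mul] at h
    refine h.congr_fun fun y => ?_
    by_cases hy : r y = Msup r
    · rw [pstarM, if_pos hy, div_right_comm, div_self (hfull y).ne', one_div, Real.log_inv]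
    · simp [pstarM, hy]

end
end
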